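/- Let r₀ ∈ (−1, 1), k ∈ ℝ, and c, g ∈ ℝ. Define r(t) = tanh(t + artanh r₀), x(t) = (1 + r(t))·tanh(c − k·log(1 − r(t))), and y(t) = g·exp(t)·(1/cosh(t + artanh r₀))·(1/cosh(c − k·log(1 − r(t)))). Then for every t ∈ ℝ: x is differentiable at t with x′(t) = k·(1 + r(t))² + (1 − r(t))·x(t) − k·x(t)², and y is differentiable at t with y′(t) = (1 − r(t) − k·x(t))·y(t). -/

import Mathlib

/-- The real inverse hyperbolic tangent, `artanh x = (1/2) log((1+x)/(1-x))`. -/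
noncomputable def artanh (x : ℝ) : ℝ := (1 / 2) * Real.log ((1 + x) / (1 - x))

theorem Real.hasDerivAt_tanh_one_sub_sq (s : ℝ) :
    HasDerivAt Real.tanh (1 - Real.tanh s ^ 2) s := by
  have hc : Real.cosh s ≠ 0 := (Real.cosh_pos s).ne'
  have h := (Real.hasDerivAt_sinh s).div (Real.hasDerivAt_cosh s) hc
  have hfun : Real.tanh = Real.sinh / Real.cosh :=
    funext fun z => Real.tanh_eq_sinh_div_cosh z
  rw [hfun]
  refine h.congr_deriv ?_
  simp only [Pi.div_apply]
  field_simp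

theorem Real.hasDerivAt_one_div_cosh (s : ℝ) :
    HasDerivAt (fun s => 1 / Real.cosh s) (-Real.tanh s * (1 / Real.cosh s)) s := by
  have hc : Real.cosh s ≠ 0 := (Real.cosh_pos s).ne'
  refine ((hasDerivAt_const s (1 : ℝ)).fun_div (Real.hasDerivAt_cosh s) hc).congr_deriv ?_
  rw [Real.tanh_eq_sinh_div_cosh]
  field_simp
  ring

theorem exact_solution_traceR22_traceR22S
    (r₀ : ℝ) (hr₀ : r₀ ∈ Set.Ioo (-1 : ℝ) 1) (k c g : ℝ)
    (r x y : ℝ → ℝ)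
    (hr : ∀ t, r t = Real.tanh (t + artanh r₀))
    (hx : ∀ t, x t = (1 + r t) * Real.tanh (c - k * Real.log (1 - r t)))
    (hy : ∀ t, y t = g * Real.exp t * (1 / Real.cosh (t + artanh r₀)) *
        (1 / Real.cosh (c - k * Real.log (1 - r t)))) :
    (∀ t : ℝ, HasDerivAt x (k * (1 + r t) ^ 2 + (1 - r t) * x t - k * x t ^ 2) t) ∧
    (∀ t : ℝ, HasDerivAt y ((1 - r t - k * x t) * y t) t) := by
  obtain rfl : x = _ := funext hx
  obtain rfl : y = _ := funext hy
  have hshift (t : ℝ) : HasDerivAt (fun t => t + artanh r₀) 1 t :=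
    (hasDerivAt_id t).add_const _
  have hr' (t : ℝ) : HasDerivAt r (1 - r t ^ 2) t := by
    have h := (Real.hasDerivAt_tanh_one_sub_sq (t + artanh r₀)).comp t (hshift t)
    rw [← hr, mul_one] at h
    exact h.congr_of_eventuallyEq (.of_forall hr)
  have hne (t : ℝ) : 1 - r t ≠ 0 := by
    rw [hr]
    exact (sub_pos.mpr (Real.tanh_lt_one _)).ne'
  have hphase (t : ℝ) :
      HasDerivAt (fun t => c - k * Real.log (1 - r t)) (k * (1 + r t)) t := by
    refine (((((hr' t).const_sub 1).log (hne t)).const_mul k).const_sub c).congr_deriv ?_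
    have := hne t
    field_simp
    ring
  refine ⟨fun t => ?_, fun t => ?_⟩
  · have htanh := (Real.hasDerivAt_tanh_one_sub_sq _).comp t (hphase t)
    refine (((hr' t).const_add 1).mul htanh).congr_deriv ?_
    simp only [Function.comp_apply]
    ring
  · have hsech := (Real.hasDerivAt_one_div_cosh _).comp t (hshift t)
    have hsech' := (Real.hasDerivAt_one_div_cosh _).comp t (hphase t)
    refine ((((Real.hasDerivAt_exp t).const_mul g).mul hsech).mul hsech').congr_deriv ?_
    simp only [Function.comp_apply, Pi.mul_apply, ← hr]
    ring
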